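/- Let α ∈ ℝ and let ν be an m^α-invariant measure of the subcritical BGW process killed at 0. Then: (i) for every β < α with β > 0 there exists C < ∞ such that ∑_{k ≥ x} ν(k) ≤ C·x^{−β} for every real x ≥ 1; (ii) for every β < α with β ≤ 0 there exists C < ∞ such that ∑_{1 ≤ k ≤ x} ν(k) ≤ C·x^{−β} for every real x ≥ 1; (iii) ∑_{n≥1} ν(n)·zⁿ < ∞ for every z ∈ [0,1); (iv) if α > 0 then ∑_{n≥1} ν(n) < ∞. -/

import Mathlib

open MeasureTheory Real Set

/-- `convPow q i j` is the `i`-fold convolution power of the offspring distribution `q`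
evaluated at `j`, i.e. the transition matrix `P₀(i,j)` of the BGW process. -/
noncomputable def convPow (q : ℕ → ℝ) : ℕ → ℕ → ℝ
  | 0, j => if j = 0 then 1 else 0
  | i + 1, j => ∑ k ∈ Finset.range (j + 1), convPow q i (j - k) * q k

/-- `ν` is a `lam`-invariant measure on `ℕ* = {1,2,…}` of the BGW process killed at 0. -/
def IsInvMeasure (q : ℕ → ℝ) (lam : ℝ) (ν : ℕ → ℝ) : Prop :=
  (∀ n, 0 ≤ ν n) ∧ ν 0 = 0 ∧
  ∀ j : ℕ, 1 ≤ j →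
    Summable (fun i => ν i * convPow q i j) ∧
    ∑' i, ν i * convPow q i j = lam * ν j


lemma convPow_nonneg (q : ℕ → ℝ) (hq0 : ∀ k, 0 ≤ q k) (i j : ℕ) : 0 ≤ convPow q i j := by
  induction i generalizing j with
  | zero => simp only [convPow]; split_ifs <;> norm_num
  | succ i ih => exact Finset.sum_nonneg fun k _ => mul_nonneg (ih _) (hq0 _)

lemma convPow_zero (q : ℕ → ℝ) (i : ℕ) : convPow q i 0 = q 0 ^ i := by
  induction i with
  | zero => simp [convPow]
  | succ i ih => simp [convPow, ih, pow_succ]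

lemma convPow_ge (q : ℕ → ℝ) (hq0 : ∀ k, 0 ≤ q k) (i j : ℕ) :
    q 0 ^ i * q j ≤ convPow q (i + 1) j := by
  rw [convPow]
  have := Finset.single_le_sum (f := fun k => convPow q i (j - k) * q k)
    (fun k _ => mul_nonneg (convPow_nonneg q hq0 _ _) (hq0 _))
    (Finset.mem_range.2 (Nat.lt_succ_self j))
  simpa [convPow_zero] using this

lemma convPow_hasSum (q : ℕ → ℝ) (hq0 : ∀ k, 0 ≤ q k) (s f : ℝ) (hs : 0 ≤ s)
    (hf : HasSum (fun k => q k * s ^ k) f) (i : ℕ) :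
    HasSum (fun j => convPow q i j * s ^ j) (f ^ i) := by
  induction i with
  | zero =>
    have := hasSum_ite_eq (0 : ℕ) (1 : ℝ)
    simp only [pow_zero]
    refine this.congr_fun ?_ |> fun h => h
    intro j
    by_cases h : j = 0 <;> simp [convPow, h]
  | succ i ih =>
    have h1 : Summable fun j => ‖q j * s ^ j‖ := hf.summable.norm
    have h2 : Summable fun j => ‖convPow q i j * s ^ j‖ := ih.summable.norm
    have h3 := summable_norm_sum_mul_range_of_summable_norm h1 h2
    have h4 := tsum_mul_tsum_eq_tsum_sum_range_of_summable_norm h1 h2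
    have h5 : HasSum _ _ := h3.of_norm.hasSum
    rw [← h4, hf.tsum_eq, ih.tsum_eq] at h5
    rw [pow_succ, mul_comm]
    refine (h5.congr_fun ?_ : HasSum (fun j => convPow q (i + 1) j * s ^ j) (f * f ^ i))
    intro n
    simp only [convPow, Finset.sum_mul]
    refine Finset.sum_congr rfl fun k hk => ?_
    have : s ^ n = s ^ k * s ^ (n - k) := by
      rw [← pow_add]; congr 1; have := Finset.mem_range.1 hk; omega
    rw [this]; ring

lemma step_hasSum (q : ℕ → ℝ) (hq0 : ∀ k, 0 ≤ q k) (lam : ℝ) (ν : ℕ → ℝ)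
    (hν : IsInvMeasure q lam ν) (A : ℝ) (hA : HasSum (fun i => ν i * q 0 ^ i) A)
    (s f S : ℝ) (hs : 0 ≤ s)
    (hf : HasSum (fun k => q k * s ^ k) f) (hS : HasSum (fun j => ν j * s ^ j) S) :
    HasSum (fun i => ν i * f ^ i) (lam * S + A) := by
  obtain ⟨h0, hz, hinv⟩ := hν
  set F : ℕ × ℕ → ℝ := fun p => ν p.2 * convPow q p.2 p.1 * s ^ p.1 with hF
  have hF0 : 0 ≤ F := fun p =>
    mul_nonneg (mul_nonneg (h0 _) (convPow_nonneg q hq0 _ _)) (pow_nonneg hs _)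
  have hrow : ∀ j, HasSum (fun i => F (j, i)) (lam * (ν j * s ^ j) + if j = 0 then A else 0) := by
    intro j
    rcases Nat.eq_zero_or_pos j with rfl | hj
    · simpa [hF, hz, convPow_zero] using hA
    · have h1 := (hinv j hj).1.hasSum
      rw [(hinv j hj).2] at h1
      have h2 := h1.mul_right (s ^ j)
      have : j ≠ 0 := by omega
      simpa [hF, this, mul_assoc] using h2
  have htot : HasSum (fun j => lam * (ν j * s ^ j) + if j = 0 then A else 0) (lam * S + A) :=
    (hS.mul_left lam).add (hasSum_ite_eq 0 A)
  have hsum : Summable F := by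
    rw [summable_prod_of_nonneg hF0]
    refine ⟨fun j => (hrow j).summable, ?_⟩
    simp_rw [fun j => (hrow j).tsum_eq]
    exact htot.summable
  have hFs : HasSum F (lam * S + A) := by
    have h1 := hsum.hasSum.prod_fiberwise hrow
    rw [← h1.unique htot]; exact hsum.hasSum
  have hsw : HasSum (F ∘ (Equiv.prodComm ℕ ℕ)) (lam * S + A) :=
    (Equiv.hasSum_iff _).2 hFs
  refine hsw.prod_fiberwise fun i => ?_
  have := (convPow_hasSum q hq0 s f hs hf i).mul_left (ν i)
  simpa [hF, Function.comp_def, mul_assoc] using this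

/-- Iterates of the generating function at zero. -/
noncomputable def gwIter (q : ℕ → ℝ) : ℕ → ℝ
  | 0 => 0
  | n + 1 => ∑' k, q k * gwIter q n ^ k


lemma gen_summable (q : ℕ → ℝ) (hq0 : ∀ k, 0 ≤ q k) (hq1 : HasSum q 1)
    (s : ℝ) (hs : 0 ≤ s) (hs1 : s ≤ 1) : Summable fun k => q k * s ^ k :=
  Summable.of_nonneg_of_le (fun k => mul_nonneg (hq0 k) (pow_nonneg hs k))
    (fun k => mul_le_of_le_one_right (hq0 k) (pow_le_one₀ hs hs1)) hq1.summable

lemma gen_one_sub (q : ℕ → ℝ) (hq0 : ∀ k, 0 ≤ q k) (hq1 : HasSum q 1)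
    (s : ℝ) (hs : 0 ≤ s) (hs1 : s ≤ 1) :
    HasSum (fun k => q k * (1 - s ^ k)) (1 - ∑' k, q k * s ^ k) := by
  have := hq1.sub (gen_summable q hq0 hq1 s hs hs1).hasSum
  simpa [mul_sub] using this

lemma exists_pos_q (q : ℕ → ℝ) (hq0 : ∀ k, 0 ≤ q k)
    (m : ℝ) (hm : HasSum (fun k : ℕ => (k : ℝ) * q k) m) (hm0 : 0 < m) :
    ∃ j, 1 ≤ j ∧ 0 < q j := by
  by_contra! h
  have : (fun k : ℕ => (k : ℝ) * q k) = fun _ => 0 := by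
    funext k
    rcases Nat.eq_zero_or_pos k with rfl | hk
    · simp
    · rw [le_antisymm (h k hk) (hq0 k), mul_zero]
  rw [this] at hm
  exact hm0.ne (hasSum_zero.unique hm)

lemma gen_upper (q : ℕ → ℝ) (hq0 : ∀ k, 0 ≤ q k) (hq1 : HasSum q 1)
    (m : ℝ) (hm : HasSum (fun k : ℕ => (k : ℝ) * q k) m)
    (s : ℝ) (hs : 0 ≤ s) (hs1 : s ≤ 1) :
    1 - ∑' k, q k * s ^ k ≤ m * (1 - s) := by
  refine hasSum_le (fun k => ?_) (gen_one_sub q hq0 hq1 s hs hs1) (hm.mul_right (1 - s))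
  have := one_add_mul_le_pow (a := s - 1) (by linarith) k
  rw [show 1 + (s - 1) = s by ring] at this
  nlinarith [hq0 k]

lemma gwIter_bounds (q : ℕ → ℝ) (hq0 : ∀ k, 0 ≤ q k) (hq1 : HasSum q 1)
    (m : ℝ) (hm : HasSum (fun k : ℕ => (k : ℝ) * q k) m) (hm0 : 0 < m) (n : ℕ) :
    0 ≤ gwIter q n ∧ gwIter q n < 1 ∧ 1 - gwIter q n ≤ m ^ n := by
  induction n with
  | zero => simp [gwIter]
  | succ n ih =>
    obtain ⟨h0, h1, h2⟩ := ih
    refine ⟨tsum_nonneg fun k => mul_nonneg (hq0 k) (pow_nonneg h0 k), ?_, ?_⟩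
    · obtain ⟨j, hj, hqj⟩ := exists_pos_q q hq0 m hm hm0
      have h3 := le_hasSum (gen_one_sub q hq0 hq1 _ h0 h1.le) j (fun k _ =>
        mul_nonneg (hq0 k) (sub_nonneg.2 (pow_le_one₀ h0 h1.le)))
      have h4 : 0 < q j * (1 - gwIter q n ^ j) :=
        mul_pos hqj (sub_pos.2 (pow_lt_one₀ h0 h1 (by omega)))
      rw [gwIter]; linarith
    · rw [gwIter, pow_succ]
      have := gen_upper q hq0 hq1 m hm _ h0 h1.le
      nlinarith

lemma gen_lower (q : ℕ → ℝ) (hq0 : ∀ k, 0 ≤ q k) (hq1 : HasSum q 1)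
    (m : ℝ) (hm : HasSum (fun k : ℕ => (k : ℝ) * q k) m) (ρ : ℝ) (hρ : ρ < m) :
    ∃ s₀ < (1 : ℝ), ∀ s, s₀ < s → 0 ≤ s → s ≤ 1 → ρ * (1 - s) ≤ 1 - ∑' k, q k * s ^ k := by
  have h1 := (hm.tendsto_sum_nat.eventually (lt_mem_nhds hρ)).exists
  obtain ⟨K, hK⟩ := h1
  have hc : Continuous fun s : ℝ => ∑ k ∈ Finset.range K, q k * ∑ i ∈ Finset.range k, s ^ i := by
    fun_prop
  have h2 : ∀ᶠ s in nhds (1 : ℝ),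
      ρ < ∑ k ∈ Finset.range K, q k * ∑ i ∈ Finset.range k, s ^ i := by
    refine (hc.tendsto 1).eventually (lt_mem_nhds ?_)
    simpa [mul_comm] using hK
  obtain ⟨ε, hε, hb⟩ := Metric.eventually_nhds_iff.1 h2
  refine ⟨1 - ε, by linarith, fun s hs hs0 hs1 => ?_⟩
  have h3 := hb (y := s) (by rw [Real.dist_eq, abs_lt]; constructor <;> linarith)
  have h4 := sum_le_hasSum (Finset.range K) (fun k _ =>
        mul_nonneg (hq0 k) (sub_nonneg.2 (pow_le_one₀ hs0 hs1))) (gen_one_sub q hq0 hq1 s hs0 hs1)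
  refine le_trans (mul_le_mul_of_nonneg_right h3.le (by linarith)) (le_trans (le_of_eq ?_) h4)
  rw [Finset.sum_mul]
  refine Finset.sum_congr rfl fun k _ => ?_
  rw [mul_assoc, geom_sum_mul_neg]

lemma gwIter_lower (q : ℕ → ℝ) (hq0 : ∀ k, 0 ≤ q k) (hq1 : HasSum q 1)
    (m : ℝ) (hm : HasSum (fun k : ℕ => (k : ℝ) * q k) m) (hm0 : 0 < m) (hm1 : m < 1)
    (ρ : ℝ) (hρ0 : 0 < ρ) (hρ : ρ < m) :
    ∃ N : ℕ, ∃ c : ℝ, 0 < c ∧ ∀ n, c * ρ ^ n ≤ 1 - gwIter q (N + n) := by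
  obtain ⟨s₀, hs₀, h⟩ := gen_lower q hq0 hq1 m hm ρ hρ
  obtain ⟨N, hN⟩ := exists_pow_lt_of_lt_one (sub_pos.2 hs₀) hm1
  have hb := gwIter_bounds q hq0 hq1 m hm hm0
  refine ⟨N, 1 - gwIter q N, sub_pos.2 (hb N).2.1, fun n => ?_⟩
  induction n with
  | zero => simp
  | succ n ih =>
    have h5 := hb (N + n)
    have h6 : m ^ (N + n) ≤ m ^ N := pow_le_pow_of_le_one hm0.le hm1.le (by omega)
    have := h (gwIter q (N + n)) (by linarith) h5.1 h5.2.1.le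
    rw [← add_assoc, gwIter, pow_succ]
    nlinarith

lemma A_summable (q : ℕ → ℝ) (hq0 : ∀ k, 0 ≤ q k) (hq1 : HasSum q 1)
    (m : ℝ) (hm : HasSum (fun k : ℕ => (k : ℝ) * q k) m) (hm0 : 0 < m)
    (lam : ℝ) (ν : ℕ → ℝ) (hν : IsInvMeasure q lam ν) :
    Summable (fun i => ν i * q 0 ^ i) := by
  obtain ⟨h0, hz, hinv⟩ := hν
  obtain ⟨j, hj, hqj⟩ := exists_pos_q q hq0 m hm hm0
  have hq01 : q 0 ≤ 1 := le_hasSum hq1 0 fun k _ => hq0 k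
  refine Summable.of_nonneg_of_le (fun i => mul_nonneg (h0 i) (pow_nonneg (hq0 0) i))
    (fun i => ?_) ((hinv j hj).1.mul_left (q j)⁻¹)
  cases i with
  | zero => simp [hz]
  | succ i =>
    have h1 := convPow_ge q hq0 i j
    have h2 : q 0 ^ (i + 1) ≤ q 0 ^ i := pow_le_pow_of_le_one (hq0 0) hq01 (by omega)
    rw [mul_left_comm]
    refine mul_le_mul_of_nonneg_left ?_ (h0 _)
    rw [inv_mul_eq_div, le_div_iff₀ hqj]
    nlinarith

lemma gwIter_hasSum (q : ℕ → ℝ) (hq0 : ∀ k, 0 ≤ q k) (hq1 : HasSum q 1)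
    (m : ℝ) (hm : HasSum (fun k : ℕ => (k : ℝ) * q k) m) (hm0 : 0 < m)
    (lam : ℝ) (ν : ℕ → ℝ) (hν : IsInvMeasure q lam ν)
    (A : ℝ) (hA : HasSum (fun i => ν i * q 0 ^ i) A) (n : ℕ) :
    HasSum (fun i => ν i * gwIter q n ^ i) (A * ∑ k ∈ Finset.range n, lam ^ k) := by
  induction n with
  | zero =>
    have : (fun i => ν i * gwIter q 0 ^ i) = fun _ => 0 := by
      funext i
      cases i with
      | zero => simp [hν.2.1]
      | succ i => simp [gwIter]
    rw [this]; simpa using hasSum_zero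
  | succ n ih =>
    have hb := gwIter_bounds q hq0 hq1 m hm hm0 n
    have h := step_hasSum q hq0 lam ν hν A hA (gwIter q n) _ _ hb.1
      (gen_summable q hq0 hq1 _ hb.1 hb.2.1.le).hasSum ih
    rw [gwIter]
    convert h using 1
    rw [geom_sum_succ]; ring

theorem invariant_measure_tail_bounds
    (q : ℕ → ℝ) (hq0 : ∀ k, 0 ≤ q k) (hq1 : HasSum q 1)
    (m : ℝ) (hm : HasSum (fun k : ℕ => (k : ℝ) * q k) m) (hm0 : 0 < m) (hm1 : m < 1)
    (α : ℝ) (ν : ℕ → ℝ) (hν : IsInvMeasure q (m ^ α) ν) :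
    (∀ β : ℝ, β < α → 0 < β → ∃ C : ℝ, ∀ x : ℝ, 1 ≤ x →
      Summable (fun k : ℕ => if x ≤ (k : ℝ) then ν k else 0) ∧
      (∑' k : ℕ, if x ≤ (k : ℝ) then ν k else 0) ≤ C * x ^ (-β)) ∧
    (∀ β : ℝ, β < α → β ≤ 0 → ∃ C : ℝ, ∀ x : ℝ, 1 ≤ x →
      (∑ k ∈ Finset.Icc 1 ⌊x⌋₊, ν k) ≤ C * x ^ (-β)) ∧
    (∀ z ∈ Set.Ico (0 : ℝ) 1, Summable fun n => ν n * z ^ n) ∧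
    (0 < α → Summable ν) := by

  set lam := m ^ α with hlam
  have hlam0 : 0 < lam := rpow_pos_of_pos hm0 α
  have hν0 := hν.1
  obtain ⟨A, hA⟩ := A_summable q hq0 hq1 m hm hm0 lam ν hν
  have hA0 : 0 ≤ A := hA.nonneg fun i => mul_nonneg (hν0 i) (pow_nonneg (hq0 0) i)
  have hG := gwIter_hasSum q hq0 hq1 m hm hm0 lam ν hν A hA
  have hb := gwIter_bounds q hq0 hq1 m hm hm0
  have hlim : Filter.Tendsto (gwIter q) Filter.atTop (nhds 1) := by
    have h1 : Filter.Tendsto (fun n => 1 - m ^ n) Filter.atTop (nhds (1 - 0)) :=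
      (tendsto_pow_atTop_nhds_zero_of_lt_one hm0.le hm1).const_sub 1
    rw [sub_zero] at h1
    exact tendsto_of_tendsto_of_tendsto_of_le_of_le h1 tendsto_const_nhds
      (fun n => by linarith [(hb n).2.2]) (fun n => (hb n).2.1.le)
  have hgeom : lam < 1 → ∀ n, ∑ k ∈ Finset.range n, lam ^ k = (1 - lam ^ n) / (1 - lam) := by
    intro h n
    rw [eq_div_iff (by linarith), geom_sum_mul_neg]
  have hgle : lam < 1 → ∀ n, A * ∑ k ∈ Finset.range n, lam ^ k ≤ A / (1 - lam) := by
    intro h n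
    rw [hgeom h, ← mul_div_assoc]
    have : 0 < 1 - lam := by linarith
    gcongr
    nlinarith [pow_pos hlam0 n]
  have hpart : lam < 1 → ∀ t : Finset ℕ, ∑ k ∈ t, ν k ≤ A / (1 - lam) := by
    intro h t
    have hc : Continuous fun s : ℝ => ∑ k ∈ t, ν k * s ^ k := by fun_prop
    have h1 := (hc.tendsto 1).comp hlim
    simp only [one_pow, mul_one] at h1
    refine le_of_tendsto' h1 fun n => ?_
    exact (sum_le_hasSum t (fun k _ => mul_nonneg (hν0 k) (pow_nonneg (hb n).1 k)) (hG n)).trans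
      (hgle h n)
  have hsumm : lam < 1 → Summable ν := fun h => summable_of_sum_le hν0 (hpart h)
  have hlt1 : 0 < α → lam < 1 := fun h => rpow_lt_one hm0.le hm1 h
  refine ⟨?_, ?_, ?_, fun h => hsumm (hlt1 h)⟩
  · intro β hβα hβ
    have hα : 0 < α := hβ.trans hβα
    have hl1 := hlt1 hα
    have hl1' : 0 < 1 - lam := by linarith
    have hsν := hsumm hl1
    have htot : ∑' k, ν k ≤ A / (1 - lam) := hsν.tsum_le_of_sum_le (hpart hl1)
    have hS : ∀ x : ℝ, Summable (fun k : ℕ => if x ≤ (k : ℝ) then ν k else 0) := fun x =>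
      Summable.of_nonneg_of_le (fun k => by split_ifs; exacts [hν0 k, le_rfl])
        (fun k => by split_ifs; exacts [le_rfl, hν0 k]) hsν
    set ρ := m ^ (α / β) with hρdef
    have hρ0 : 0 < ρ := rpow_pos_of_pos hm0 _
    have hρm : ρ < m := by
      have := rpow_lt_rpow_of_exponent_gt hm0 hm1 ((one_lt_div hβ).2 hβα)
      simpa using this
    have hρβ : ρ ^ β = lam := by
      rw [hρdef, ← rpow_mul hm0.le, div_mul_cancel₀ _ hβ.ne']
    obtain ⟨N, c, hc, hlow⟩ := gwIter_lower q hq0 hq1 m hm hm0 hm1 ρ hρ0 hρm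
    refine ⟨max (A / (1 - lam) * c ^ (-β)) (2 * A / (1 - lam) * (ρ * c) ^ (-β)),
      fun x hx => ⟨hS x, ?_⟩⟩
    have hx0 : 0 < x := by linarith
    have hxβ : 0 < x ^ (-β) := rpow_pos_of_pos hx0 _
    rcases lt_or_ge (c * x) 1 with hcx | hcx
    · refine le_trans ?_ (mul_le_mul_of_nonneg_right (le_max_left _ _) hxβ.le)
      have h1 : (∑' k : ℕ, if x ≤ (k : ℝ) then ν k else 0) ≤ ∑' k, ν k :=
        (hS x).tsum_le_tsum (fun k => by split_ifs; exacts [le_rfl, hν0 k]) hsν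
      have h2 : 1 ≤ c ^ (-β) * x ^ (-β) := by
        rw [← mul_rpow hc.le hx0.le]
        exact one_le_rpow_of_pos_of_le_one_of_nonpos (by positivity) hcx.le (by linarith)
      have h3 : 0 ≤ A / (1 - lam) := by positivity
      nlinarith
    · refine le_trans ?_ (mul_le_mul_of_nonneg_right (le_max_right _ _) hxβ.le)
      obtain ⟨n, hn1, hn2⟩ := exists_nat_pow_near_of_lt_one (x := 1 / (c * x)) (y := ρ)
        (by positivity) (by rw [div_le_one (by positivity)]; exact hcx) hρ0 (hρm.trans hm1)
      set a := gwIter q (N + n) with ha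
      have ha0 := (hb (N + n)).1
      have ha1 := (hb (N + n)).2.1
      have hax : 1 / x ≤ 1 - a := by
        refine le_trans ?_ (hlow n)
        rw [div_le_iff₀ hx0]
        rw [div_le_iff₀ (by positivity)] at hn2
        linarith
      have hterm : ∀ k : ℕ, (if x ≤ (k : ℝ) then ν k else 0) ≤ 2 * (ν k - ν k * a ^ k) := by
        intro k
        split_ifs with hk
        · have h1 : a ^ k ≤ 1 / 2 := by
            have h2 : a ≤ exp (a - 1) := by linarith [add_one_le_exp (a - 1)]
            have h3 : a ^ k ≤ exp (k * (a - 1)) := by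
              rw [exp_nat_mul]; exact pow_le_pow_left₀ ha0 h2 k
            have h4 : (k : ℝ) * (a - 1) ≤ -1 := by
              rw [div_le_iff₀ hx0] at hax
              nlinarith
            have h5 := exp_le_exp.2 h4
            have h6 : exp (-1) ≤ 1 / 2 := by
              rw [exp_neg, ← one_div]
              exact one_div_le_one_div_of_le (by norm_num) (by linarith [add_one_le_exp (1:ℝ)])
            linarith
          nlinarith [hν0 k]
        · have : a ^ k ≤ 1 := pow_le_one₀ ha0 ha1.le
          nlinarith [hν0 k]
      have h7 := hasSum_le hterm (hS x).hasSum ((hsν.hasSum.sub (hG (N + n))).mul_left 2)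
      rw [hgeom hl1] at h7
      have h8 : lam ^ (N + n) ≤ lam ^ n := pow_le_pow_of_le_one hlam0.le hl1.le (by omega)
      have h9 : lam ^ n ≤ (ρ * c) ^ (-β) * x ^ (-β) := by
        rw [← mul_rpow (by positivity) hx0.le, rpow_neg (by positivity),
          ← inv_rpow (by positivity), ← hρβ, ← rpow_natCast, ← rpow_mul hρ0.le, mul_comm β,
          rpow_mul hρ0.le, rpow_natCast]
        refine rpow_le_rpow (by positivity) ?_ hβ.le
        rw [lt_div_iff₀ (by positivity)] at hn1
        rw [← one_div, le_div_iff₀ (by positivity)]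
        calc ρ ^ n * (ρ * c * x) = ρ ^ (n + 1) * (c * x) := by ring
          _ ≤ 1 := hn1.le
      calc _ ≤ 2 * (∑' k, ν k - A * ((1 - lam ^ (N + n)) / (1 - lam))) := h7
        _ ≤ 2 * (A / (1 - lam) - A * ((1 - lam ^ (N + n)) / (1 - lam))) := by gcongr
        _ = 2 * A / (1 - lam) * lam ^ (N + n) := by field_simp; ring
        _ ≤ 2 * A / (1 - lam) * ((ρ * c) ^ (-β) * x ^ (-β)) := by
          gcongr; exact h8.trans h9
        _ = _ := by ring
  · intro β hβα hβ
    rcases hβ.lt_or_eq with hβ | hβ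
    · set μ := m ^ β with hμ
      have hμ1 : 1 < μ := one_lt_rpow_of_pos_of_lt_one_of_neg hm0 hm1 hβ
      have hμ1' : 0 < μ - 1 := by linarith
      have hlμ : lam ≤ μ := (rpow_lt_rpow_of_exponent_gt hm0 hm1 hβα).le
      refine ⟨2 * (A * (μ / (μ - 1) * 2 ^ (-β))), fun x hx => ?_⟩
      have hx0 : 0 < x := by linarith
      obtain ⟨n, hn1, hn2⟩ := exists_nat_pow_near_of_lt_one (x := 1 / (2 * x)) (y := m)
        (by positivity) (by rw [div_le_one (by positivity)]; linarith) hm0 hm1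
      have h1 : 1 - gwIter q (n + 1) ≤ 1 / (2 * x) := (hb (n + 1)).2.2.trans hn1.le
      have h2 : ∀ k ∈ Finset.Icc 1 ⌊x⌋₊, ν k ≤ 2 * (ν k * gwIter q (n + 1) ^ k) := by
        intro k hk
        have hkx : (k : ℝ) ≤ x := (Nat.le_floor_iff hx0.le).1 (Finset.mem_Icc.1 hk).2
        have h3 := one_add_mul_le_pow (a := gwIter q (n + 1) - 1)
          (by linarith [(hb (n + 1)).1]) k
        rw [show 1 + (gwIter q (n + 1) - 1) = gwIter q (n + 1) by ring] at h3
        have h4 : (k : ℝ) * (1 - gwIter q (n + 1)) ≤ 1 / 2 := by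
          calc (k : ℝ) * (1 - gwIter q (n + 1)) ≤ x * (1 / (2 * x)) :=
                mul_le_mul hkx h1 (by linarith [(hb (n + 1)).2.1]) hx0.le
            _ = 1 / 2 := by field_simp
        nlinarith [hν0 k]
      have h5 := sum_le_hasSum (Finset.Icc 1 ⌊x⌋₊)
        (fun k _ => mul_nonneg (hν0 k) (pow_nonneg (hb (n + 1)).1 k)) (hG (n + 1))
      have h6 : ∑ k ∈ Finset.range (n + 1), lam ^ k ≤ μ ^ (n + 1) / (μ - 1) := by
        calc _ ≤ ∑ k ∈ Finset.range (n + 1), μ ^ k :=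
              Finset.sum_le_sum fun k _ => pow_le_pow_left₀ hlam0.le hlμ k
          _ = (μ ^ (n + 1) - 1) / (μ - 1) := geom_sum_eq hμ1.ne' _
          _ ≤ _ := by gcongr; linarith
      have h7 : μ ^ n ≤ 2 ^ (-β) * x ^ (-β) := by
        rw [← mul_rpow (by norm_num) hx0.le, hμ, ← rpow_natCast, ← rpow_mul hm0.le, mul_comm β,
          rpow_mul hm0.le, rpow_natCast, rpow_neg (by positivity), ← inv_rpow (by positivity),
          ← one_div]
        exact rpow_le_rpow_of_nonpos (by positivity) hn2 hβ.le
      calc _ ≤ ∑ k ∈ Finset.Icc 1 ⌊x⌋₊, 2 * (ν k * gwIter q (n + 1) ^ k) := Finset.sum_le_sum h2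
        _ = 2 * ∑ k ∈ Finset.Icc 1 ⌊x⌋₊, ν k * gwIter q (n + 1) ^ k := by rw [Finset.mul_sum]
        _ ≤ 2 * (A * (μ ^ (n + 1) / (μ - 1))) := by
          gcongr; exact h5.trans (mul_le_mul_of_nonneg_left h6 hA0)
        _ = 2 * (A * (μ / (μ - 1) * μ ^ n)) := by ring
        _ ≤ 2 * (A * (μ / (μ - 1) * (2 ^ (-β) * x ^ (-β)))) := by gcongr
        _ = _ := by ring
    · subst hβ
      exact ⟨A / (1 - lam), fun x hx => by simpa using hpart (hlt1 hβα) _⟩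
  · intro z hz
    obtain ⟨n, hn⟩ := (hlim.eventually (lt_mem_nhds hz.2)).exists
    exact Summable.of_nonneg_of_le (fun k => mul_nonneg (hν0 k) (pow_nonneg hz.1 k))
      (fun k => mul_le_mul_of_nonneg_left (pow_le_pow_left₀ hz.1 hn.le k) (hν0 k)) (hG n).summable
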